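/- Let d ≥ 1, p > 0 and β < α < 2. Then the transform 𝔗_{β→α,p} is one-to-one on its domain: if M, M′ ∈ 𝔇(𝔗_{β→α,p}) and 𝔗_{β→α,p} M = 𝔗_{β→α,p} M′, then M = M′. -/

import Mathlib

open MeasureTheory Set

noncomputable section

variable {E : Type*} [NormedAddCommGroup E] [NormedSpace ℝ E]
  [MeasurableSpace E] [BorelSpace E]

/-- The upsilon transform with dilation measure `ρ` on `(0,∞) ⊆ ℝ`:
`[Υ_ρ M](B) = ∫ M(s⁻¹ B) ρ(ds)`, realized as the image of `ρ ⊗ M` under `(s, x) ↦ s • x`. -/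
def Upsilon (ρ : Measure ℝ) (M : Measure E) : Measure E :=
  Measure.map (fun sx : ℝ × E => sx.1 • sx.2) (ρ.prod M)

/-- `M` is a Lévy measure: σ-finite, no mass at `0`, and `∫ (|x|² ∧ 1) M(dx) < ∞`. -/
def IsLevyMeasure (M : Measure E) : Prop :=
  SigmaFinite M ∧ M {0} = 0 ∧
    ∫⁻ x, ENNReal.ofReal (min (‖x‖ ^ 2) 1) ∂M < ⊤

/-- The domain `𝔇(Υ_ρ)`: Lévy measures `M` such that `Υ_ρ M` is again a Lévy measure. -/
def UpsilonDomain (ρ : Measure ℝ) : Set (Measure E) :=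
  {M | IsLevyMeasure M ∧ IsLevyMeasure (Upsilon ρ M)}

/-- The range `ℜ(Υ_ρ) = {Υ_ρ M : M ∈ 𝔇(Υ_ρ)}`. -/
def UpsilonRange (ρ : Measure ℝ) : Set (Measure E) :=
  Upsilon ρ '' UpsilonDomain (E := E) ρ

/-- The class `𝔐^α`: Borel measures with `M({0}) = 0` and `∫ (|x|² ∧ |x|^α) M(dx) < ∞`. -/
def MemMAlpha (α : ℝ) (M : Measure E) : Prop :=
  M {0} = 0 ∧ ∫⁻ x, ENNReal.ofReal (min (‖x‖ ^ 2) (‖x‖ ^ α)) ∂M < ⊤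

/-- The class `𝔐^log`: Lévy measures with `∫_{|x|>1} log|x| M(dx) < ∞`. -/
def MemMLog (M : Measure E) : Prop :=
  IsLevyMeasure M ∧
    ∫⁻ x in {x : E | 1 < ‖x‖}, ENNReal.ofReal (Real.log ‖x‖) ∂M < ⊤

/-- The dilation measure `ψ_{α,p}(ds) = s^{-α-1} e^{-s^p} 1_{s>0} ds`. -/
def psiMeasure (α p : ℝ) : Measure ℝ :=
  (volume : Measure ℝ).withDensity fun s =>
    if 0 < s then ENNReal.ofReal (s ^ (-α - 1) * Real.exp (-(s ^ p))) else 0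

/-- `K_{α,β,p} = ∫₀^∞ u^{α-β-1} e^{-u^p} du`. -/
def Kconst (α β p : ℝ) : ℝ :=
  ∫ u in Ioi (0 : ℝ), u ^ (α - β - 1) * Real.exp (-(u ^ p))

/-- The dilation measure
`τ_{β→α,p}(ds) = K_{α,β,p}⁻¹ s^{-α-1} (1-s^p)^{(α-β)/p - 1} 1_{0<s<1} ds`. -/
def tauMeasure (β α p : ℝ) : Measure ℝ :=
  (volume : Measure ℝ).withDensity fun s =>
    if 0 < s ∧ s < 1 then
      ENNReal.ofReal ((Kconst α β p)⁻¹ * (s ^ (-α - 1) * (1 - s ^ p) ^ ((α - β) / p - 1)))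
    else 0

/-- `f` is the density of the fully right-skewed `r`-stable distribution on `(0,∞)`:
a nonnegative measurable function with `∫₀^∞ e^{-t x} f(x) dx = e^{-t^r}` for all `t ≥ 0`. -/
def IsStableDensity (r : ℝ) (f : ℝ → ℝ) : Prop :=
  Measurable f ∧ (∀ x, 0 ≤ f x) ∧
    ∀ t : ℝ, 0 ≤ t →
      ∫ x in Ioi (0 : ℝ), Real.exp (-(t * x)) * f x = Real.exp (-(t ^ r))

/-- The dilation measure `π_{α,p→q}(ds) = p f_{q/p}(s^{-p}) s^{-α-p-1} 1_{s>0} ds`,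
where `f` is (to be assumed) the density of the fully right-skewed `q/p`-stable law. -/
def piMeasure (f : ℝ → ℝ) (α p : ℝ) : Measure ℝ :=
  (volume : Measure ℝ).withDensity fun s =>
    if 0 < s then ENNReal.ofReal (p * f (s ^ (-p)) * s ^ (-α - p - 1)) else 0

/-- The measure `ρ(ds) = g(s) 1_{s>0} ds`. -/
def densMeasure (g : ℝ → ℝ) : Measure ℝ :=
  (volume : Measure ℝ).withDensity fun s => if 0 < s then ENNReal.ofReal (g s) else 0

section Laplace

open ProbabilityTheory

lemma ext_of_mgf_eventuallyEq {μ ν : Measure ℝ} [IsFiniteMeasure μ] [IsFiniteMeasure ν]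
    (hμ : 0 ∈ interior (integrableExpSet id μ)) (hν : 0 ∈ interior (integrableExpSet id ν))
    (h : mgf id μ =ᶠ[nhds 0] mgf id ν) : μ = ν := by
  set I := interior (integrableExpSet id μ) ∩ interior (integrableExpSet id ν) with hI
  have hμa : AnalyticOnNhd ℂ (complexMGF id μ) {z | z.re ∈ I} :=
    analyticOnNhd_complexMGF.mono fun z hz => hz.1
  have hνa : AnalyticOnNhd ℂ (complexMGF id ν) {z | z.re ∈ I} :=
    analyticOnNhd_complexMGF.mono fun z hz => hz.2
  have hconv : Convex ℝ I := convex_integrableExpSet.interior.inter convex_integrableExpSet.interior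
  have hfreq : ∃ᶠ z in nhdsWithin ((0 : ℝ) : ℂ) {((0 : ℝ) : ℂ)}ᶜ,
      complexMGF id μ z = complexMGF id ν z := by
    have hreal : ∃ᶠ x : ℝ in nhdsWithin (0 : ℝ) {0}ᶜ,
        complexMGF id μ (x : ℂ) = complexMGF id ν (x : ℂ) := by
      refine Filter.Eventually.frequently ?_
      filter_upwards [nhdsWithin_le_nhds h] with x hx
      rw [complexMGF_ofReal, complexMGF_ofReal, hx]
    have ht : Filter.Tendsto (fun x : ℝ => (x : ℂ)) (nhdsWithin (0 : ℝ) {0}ᶜ)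
        (nhdsWithin ((0 : ℝ) : ℂ) {((0 : ℝ) : ℂ)}ᶜ) := by
      refine tendsto_nhdsWithin_of_tendsto_nhds_of_eventually_within _
        (Complex.continuous_ofReal.continuousAt.mono_left nhdsWithin_le_nhds) ?_
      filter_upwards [self_mem_nhdsWithin] with x hx
      simpa using hx
    exact ht.frequently hreal
  have hEq : Set.EqOn (complexMGF id μ) (complexMGF id ν) {z | z.re ∈ I} :=
    hμa.eqOn_of_preconnected_of_frequently_eq hνa
      (hconv.linear_preimage Complex.reLm).isPreconnected (by simpa using ⟨hμ, hν⟩) hfreq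
  refine Measure.ext_of_charFun (funext fun t => ?_)
  rw [← complexMGF_id_mul_I, ← complexMGF_id_mul_I]
  exact hEq (by simpa using ⟨hμ, hν⟩)

end Laplace

section TauKernel

lemma Kconst_eq {α β p : ℝ} (hβα : β < α) (hp : 0 < p) :
    Kconst α β p = 1 / p * Real.Gamma ((α - β) / p) := by
  rw [Kconst, integral_rpow_mul_exp_neg_rpow hp (by linarith)]
  ring_nf

lemma Kconst_pos {α β p : ℝ} (hβα : β < α) (hp : 0 < p) : 0 < Kconst α β p := by
  rw [Kconst_eq hβα hp]
  have := Real.Gamma_pos_of_pos (div_pos (sub_pos.2 hβα) hp)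
  positivity

lemma lintegral_tauMeasure (β α p : ℝ) (h : ℝ → ENNReal) :
    ∫⁻ s, h s ∂tauMeasure β α p = ∫⁻ s in Ioo 0 1,
      ENNReal.ofReal ((Kconst α β p)⁻¹ * (s ^ (-α - 1) * (1 - s ^ p) ^ ((α - β) / p - 1))) *
        h s := by
  rw [tauMeasure, lintegral_withDensity_eq_lintegral_mul_non_measurable _ ?_ ?_,
    ← lintegral_indicator measurableSet_Ioo]
  · refine lintegral_congr fun s => ?_
    by_cases hs : 0 < s ∧ s < 1
    · simp [hs]
    · rw [indicator_of_notMem (by simpa using hs)]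
      simp [hs]
  · exact Measurable.ite (measurableSet_Ioo (a := (0 : ℝ)) (b := 1)) (by fun_prop) (by fun_prop)
  · refine Filter.Eventually.of_forall fun s => ?_
    split_ifs <;> simp

lemma image_one_add_rpow {p : ℝ} (hp : 0 < p) :
    (fun u : ℝ => (1 + u) ^ (-(1 / p))) '' Ioi 0 = Ioo 0 1 := by
  ext s
  simp only [mem_image, mem_Ioi, mem_Ioo]
  constructor
  · rintro ⟨u, hu, rfl⟩
    exact ⟨by positivity, Real.rpow_lt_one_of_one_lt_of_neg (by linarith) (by simpa using hp)⟩
  · rintro ⟨h0, h1⟩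
    refine ⟨s ^ (-p) - 1, ?_, ?_⟩
    · have := Real.one_lt_rpow_of_pos_of_lt_one_of_neg h0 h1 (neg_neg_of_pos hp)
      linarith
    · rw [add_sub_cancel, ← Real.rpow_mul h0.le]
      have : -p * -(1 / p) = 1 := by field_simp
      rw [this, Real.rpow_one]

lemma tau_integrand_comp {β α p : ℝ} (hp : 0 < p) {lam r u K : ℝ} (hr : 0 < r) (hu : 0 < u) :
    |-(1 / p) * (1 + u) ^ (-(1 / p) - 1)| *
      ((K * (((1 + u) ^ (-(1 / p))) ^ (-α - 1) *
          (1 - ((1 + u) ^ (-(1 / p))) ^ p) ^ ((α - β) / p - 1))) *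
        (((1 + u) ^ (-(1 / p)) * r) ^ β *
          Real.exp (-(lam * ((1 + u) ^ (-(1 / p)) * r) ^ (-p))))) =
    (K / p * (r ^ β * Real.exp (-(lam * r ^ (-p))))) *
      (u ^ ((α - β) / p - 1) * Real.exp (-(lam * r ^ (-p) * u))) := by
  set b := 1 + u with hb
  have hb0 : 0 < b := by positivity
  have e1 : (b ^ (-(1 / p))) ^ p = b⁻¹ := by
    rw [← Real.rpow_mul hb0.le, ← Real.rpow_neg_one]
    congr 1; field_simp
  have e2 : 1 - b⁻¹ = u * b⁻¹ := by field_simp; linarith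
  have e3 : (b ^ (-(1 / p)) * r) ^ (-p) = b * r ^ (-p) := by
    rw [Real.mul_rpow (by positivity) hr.le, Real.rpow_neg (by positivity), e1, inv_inv]
  have e4 : (b ^ (-(1 / p)) * r) ^ β = b ^ (-(1 / p) * β) * r ^ β := by
    rw [Real.mul_rpow (by positivity) hr.le, ← Real.rpow_mul hb0.le]
  have e5 : (u * b⁻¹) ^ ((α - β) / p - 1) = u ^ ((α - β) / p - 1) * b ^ (1 - (α - β) / p) := by
    rw [Real.mul_rpow hu.le (by positivity), Real.inv_rpow hb0.le, ← Real.rpow_neg hb0.le,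
      neg_sub]
  have e6 : |-(1 / p) * b ^ (-(1 / p) - 1)| = 1 / p * b ^ (-(1 / p) - 1) := by
    rw [neg_mul, abs_neg, abs_of_pos (by positivity)]
  have e7 : b ^ (-(1 / p) - 1) * b ^ (-(1 / p) * (-α - 1)) * b ^ (1 - (α - β) / p) *
      b ^ (-(1 / p) * β) = 1 := by
    rw [← Real.rpow_add hb0, ← Real.rpow_add hb0, ← Real.rpow_add hb0]
    convert! Real.rpow_zero b using 2
    field_simp
    ring
  have e8 : Real.exp (-(lam * (b * r ^ (-p)))) =
      Real.exp (-(lam * r ^ (-p))) * Real.exp (-(lam * r ^ (-p) * u)) := by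
    rw [← Real.exp_add, hb]; congr 1; ring
  rw [e1, e2, e3, e4, e5, e6, e8, ← Real.rpow_mul hb0.le]
  linear_combination (K / p * (r ^ β * Real.exp (-(lam * r ^ (-p)))) *
    (u ^ ((α - β) / p - 1) * Real.exp (-(lam * r ^ (-p) * u)))) * e7

/-- The kernel of `𝔗_{β→α,p}` intertwines the functions `r ↦ r^β e^{-λ r^{-p}}` and
`r ↦ r^α e^{-λ r^{-p}}`. -/
lemma lintegral_tauMeasure_rpow_mul_exp {β α p : ℝ} (hβα : β < α) (hp : 0 < p) {lam r : ℝ}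
    (hlam : 0 < lam) (hr : 0 < r) :
    ∫⁻ s, ENNReal.ofReal ((s * r) ^ β * Real.exp (-(lam * (s * r) ^ (-p)))) ∂tauMeasure β α p =
      ENNReal.ofReal (lam ^ (-((α - β) / p))) *
        ENNReal.ofReal (r ^ α * Real.exp (-(lam * r ^ (-p)))) := by
  have hκ : 0 < (α - β) / p := div_pos (sub_pos.2 hβα) hp
  have hK := Kconst_pos hβα hp
  have hμ : 0 < lam * r ^ (-p) := by positivity
  have hderiv : ∀ u ∈ Ioi (0 : ℝ), HasDerivWithinAt (fun u : ℝ => (1 + u) ^ (-(1 / p)))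
      (-(1 / p) * (1 + u) ^ (-(1 / p) - 1)) (Ioi 0) u := by
    intro u hu
    have hu' : (0 : ℝ) < 1 + u := by have : (0 : ℝ) < u := hu; linarith
    have := ((hasDerivAt_id u).const_add 1).rpow_const (p := -(1 / p)) (Or.inl hu'.ne')
    simpa using this.hasDerivWithinAt
  have hinj : InjOn (fun u : ℝ => (1 + u) ^ (-(1 / p))) (Ioi 0) := by
    intro u hu v hv huv
    have hu' : (0 : ℝ) < u := hu
    have hv' : (0 : ℝ) < v := hv
    have := (Real.rpow_left_inj (by positivity) (by positivity)
      (neg_ne_zero.2 (one_div_ne_zero hp.ne'))).1 huv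
    linarith
  rw [lintegral_tauMeasure, ← image_one_add_rpow hp,
    lintegral_image_eq_lintegral_abs_deriv_mul measurableSet_Ioi hderiv hinj]
  rw [setLIntegral_congr_fun (g := fun u => ENNReal.ofReal
      (((Kconst α β p)⁻¹ / p * (r ^ β * Real.exp (-(lam * r ^ (-p))))) *
        (u ^ ((α - β) / p - 1) * Real.exp (-(lam * r ^ (-p) * u))))) measurableSet_Ioi]
  · have hint := Real.integral_rpow_mul_exp_neg_mul_Ioi hκ hμ
    have hΓ := Real.Gamma_pos_of_pos hκ
    have hI : IntegrableOn (fun u : ℝ =>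
        u ^ ((α - β) / p - 1) * Real.exp (-(lam * r ^ (-p) * u))) (Ioi 0) :=
      .of_integral_ne_zero (by rw [hint]; positivity)
    rw [← ofReal_integral_eq_lintegral_ofReal (hI.const_mul _), integral_const_mul, hint,
      ← ENNReal.ofReal_mul (by positivity)]
    · congr 1
      have e : (1 / (lam * r ^ (-p))) ^ ((α - β) / p) = lam ^ (-((α - β) / p)) * r ^ (α - β) := by
        rw [one_div, ← Real.rpow_neg_eq_inv_rpow, Real.mul_rpow hlam.le (by positivity),
          ← Real.rpow_mul hr.le]
        congr 2; field_simp
      have e' : r ^ α = r ^ β * r ^ (α - β) := by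
        rw [← Real.rpow_add hr]; congr 1; ring
      rw [e, e', Kconst_eq hβα hp]
      field_simp
    · filter_upwards [ae_restrict_mem measurableSet_Ioi] with u hu
      have : (0 : ℝ) < u := hu
      simp only [Pi.zero_apply]
      positivity
  · intro u hu
    have hu' : (0 : ℝ) < u := hu
    simp only
    have : (1 + u) ^ (-(1 / p)) ∈ Ioo (0 : ℝ) 1 := image_one_add_rpow hp ▸ mem_image_of_mem _ hu
    have h1 : 0 < 1 - ((1 + u) ^ (-(1 / p))) ^ p :=
      sub_pos.2 (Real.rpow_lt_one this.1.le this.2 hp)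
    have hnn : 0 ≤ (Kconst α β p)⁻¹ * (((1 + u) ^ (-(1 / p))) ^ (-α - 1) *
        (1 - ((1 + u) ^ (-(1 / p))) ^ p) ^ ((α - β) / p - 1)) :=
      mul_nonneg (inv_nonneg.2 hK.le)
        (mul_nonneg (Real.rpow_nonneg this.1.le _) (Real.rpow_nonneg h1.le _))
    rw [← tau_integrand_comp hp hr hu, ENNReal.ofReal_mul (abs_nonneg _), ENNReal.ofReal_mul hnn]

lemma min_rpow_le_rpow {a b t e : ℝ} (ha : 0 < a) (hat : a ≤ t) (htb : t ≤ b) :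
    min (a ^ e) (b ^ e) ≤ t ^ e := by
  rcases le_total 0 e with he | he
  · exact (min_le_left _ _).trans (Real.rpow_le_rpow ha.le hat he)
  · exact (min_le_right _ _).trans (Real.rpow_le_rpow_of_nonpos (ha.trans_le hat) htb he)

lemma exists_mul_rpow_le_lintegral_tauMeasure {β α p : ℝ} (hβα : β < α) (hp : 0 < p) :
    ∃ c > 0, ∀ r : ℝ, 4 ≤ r → ENNReal.ofReal (c * r ^ α) ≤
      ∫⁻ s, ENNReal.ofReal (min ((s * r) ^ 2) 1) ∂tauMeasure β α p := by
  have hK := Kconst_pos hβα hp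
  set q : ℝ := 1 - (1 / 2 : ℝ) ^ p with hq
  have hq0 : 0 < q := sub_pos.2 (Real.rpow_lt_one (by norm_num) (by norm_num) hp)
  set c₁ : ℝ := min (1 ^ (-α - 1)) (2 ^ (-α - 1)) with hc₁
  set c₂ : ℝ := min (q ^ ((α - β) / p - 1)) (1 ^ ((α - β) / p - 1)) with hc₂
  have hc₁0 : 0 < c₁ := lt_min (by positivity) (by positivity)
  have hc₂0 : 0 < c₂ := lt_min (by positivity) (by positivity)
  refine ⟨(Kconst α β p)⁻¹ * (c₁ * c₂), by positivity, fun r hr => ?_⟩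
  have hr0 : 0 < r := by linarith
  have hsub : Ioo (1 / r) (2 / r) ⊆ Ioo 0 1 := fun s hs =>
    ⟨(by positivity : 0 < 1 / r).trans hs.1,
      hs.2.trans (by rw [div_lt_one hr0]; linarith)⟩
  rw [lintegral_tauMeasure]
  calc ENNReal.ofReal ((Kconst α β p)⁻¹ * (c₁ * c₂) * r ^ α)
      = ∫⁻ _ in Ioo (1 / r) (2 / r),
          ENNReal.ofReal ((Kconst α β p)⁻¹ * (c₁ * r ^ (α + 1) * c₂)) := by
        rw [setLIntegral_const, Real.volume_Ioo, ← ENNReal.ofReal_mul (by positivity),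
          Real.rpow_add hr0, Real.rpow_one]
        congr 1
        field_simp
        ring
    _ ≤ ∫⁻ s in Ioo (1 / r) (2 / r), ENNReal.ofReal ((Kconst α β p)⁻¹ *
          (s ^ (-α - 1) * (1 - s ^ p) ^ ((α - β) / p - 1))) *
          ENNReal.ofReal (min ((s * r) ^ 2) 1) := by
        refine setLIntegral_mono' measurableSet_Ioo fun s hs => ?_
        have hs01 := hsub hs
        have h1 : 1 ≤ s * r := by have := hs.1; rw [div_lt_iff₀ hr0] at this; exact this.le
        have h2 : s * r ≤ 2 := by have := hs.2; rw [lt_div_iff₀ hr0] at this; exact this.le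
        have hs2 : s ≤ 1 / 2 := by nlinarith [hs01.1]
        rw [min_eq_right (by nlinarith), ENNReal.ofReal_one, mul_one]
        refine ENNReal.ofReal_le_ofReal ?_
        have a1 : c₁ * r ^ (α + 1) ≤ s ^ (-α - 1) := by
          have := min_rpow_le_rpow (e := -α - 1) one_pos h1 h2
          rw [Real.mul_rpow hs01.1.le hr0.le] at this
          have e : r ^ (-α - 1) * r ^ (α + 1) = 1 := by
            rw [← Real.rpow_add hr0, ← Real.rpow_zero r]; congr 1; ring
          calc c₁ * r ^ (α + 1) ≤ s ^ (-α - 1) * r ^ (-α - 1) * r ^ (α + 1) := by gcongr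
            _ = s ^ (-α - 1) := by rw [mul_assoc, e, mul_one]
        have a2 : c₂ ≤ (1 - s ^ p) ^ ((α - β) / p - 1) :=
          min_rpow_le_rpow hq0 (sub_le_sub_left (Real.rpow_le_rpow hs01.1.le hs2 hp.le) _)
            (sub_le_self _ (Real.rpow_nonneg hs01.1.le _))
        have := Real.rpow_nonneg hs01.1.le (-α - 1)
        gcongr
    _ ≤ _ := lintegral_mono_set hsub

lemma rpow_mul_exp_neg_le {a lam v : ℝ} (ha : 0 < a) (hlam : 0 < lam) (hv : 0 ≤ v) :
    v ^ a * Real.exp (-(lam * v)) ≤ (a / lam) ^ a := by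
  have h : v ≤ a / lam * Real.exp (lam * v / a) := by
    have := Real.add_one_le_exp (lam * v / a)
    calc v = a / lam * (lam * v / a) := by field_simp
      _ ≤ _ := by gcongr; linarith
  have h' : v ^ a ≤ (a / lam) ^ a * Real.exp (lam * v) := by
    calc v ^ a ≤ (a / lam * Real.exp (lam * v / a)) ^ a := Real.rpow_le_rpow hv h ha.le
      _ = (a / lam) ^ a * Real.exp (lam * v) := by
        rw [Real.mul_rpow (by positivity) (by positivity), ← Real.exp_mul]
        congr 2; field_simp
  rw [Real.exp_neg, ← div_eq_mul_inv, div_le_iff₀ (Real.exp_pos _)]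
  exact h'

lemma rpow_mul_exp_neg_rpow_neg_le {α p lam r : ℝ} (hα : α < 2) (hp : 0 < p) (hlam : 0 < lam)
    (hr : 0 < r) :
    r ^ α * Real.exp (-(lam * r ^ (-p))) ≤ ((2 - α) / p / lam) ^ ((2 - α) / p) * r ^ 2 := by
  have h := rpow_mul_exp_neg_le (div_pos (sub_pos.2 hα) hp) hlam (Real.rpow_nonneg hr.le (-p))
  have e : (r ^ (-p)) ^ ((2 - α) / p) * r ^ 2 = r ^ α := by
    rw [← Real.rpow_mul hr.le, ← Real.rpow_natCast, ← Real.rpow_add hr]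
    congr 1; push_cast; field_simp; ring
  rw [← e]
  calc _ = (r ^ (-p)) ^ ((2 - α) / p) * Real.exp (-(lam * r ^ (-p))) * r ^ 2 := by ring
    _ ≤ _ := by gcongr

end TauKernel

section Injectivity

variable [SecondCountableTopology E]

lemma lintegral_upsilon (ρ : Measure ℝ) [SFinite ρ] (M : Measure E) [SFinite M]
    {g : E → ENNReal} (hg : Measurable g) :
    ∫⁻ z, g z ∂Upsilon ρ M = ∫⁻ x, ∫⁻ s, g (s • x) ∂ρ ∂M := by
  have hsmul : Measurable fun sx : ℝ × E => sx.1 • sx.2 := by fun_prop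
  rw [Upsilon, lintegral_map hg hsmul,
    lintegral_prod_symm' (fun sx : ℝ × E => g (sx.1 • sx.2)) (hg.comp hsmul)]

instance (β α p : ℝ) : SFinite (tauMeasure β α p) := by
  unfold tauMeasure; infer_instance

/-- The density `x ↦ |x|^α e^{-λ |x|^{-p}}`. -/
def laplaceWeight {F : Type*} [Norm F] (α p lam : ℝ) (x : F) : ENNReal :=
  ENNReal.ofReal (‖x‖ ^ α * Real.exp (-(lam * ‖x‖ ^ (-p))))

lemma measurable_laplaceWeight {F : Type*} [NormedAddCommGroup F] [MeasurableSpace F]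
    [BorelSpace F] (α p lam : ℝ) : Measurable (laplaceWeight (F := F) α p lam) := by
  unfold laplaceWeight; fun_prop

/-- The radial projection onto the unit sphere, sending `0` to `0`. -/
def direction {F : Type*} [NormedAddCommGroup F] [NormedSpace ℝ F] (x : F) : F := ‖x‖⁻¹ • x

lemma direction_smul {F : Type*} [NormedAddCommGroup F] [NormedSpace ℝ F] {s : ℝ} (hs : 0 < s)
    (x : F) : direction (s • x) = direction x := by
  rw [direction, direction, norm_smul, smul_smul, Real.norm_of_nonneg hs.le]
  congr 1
  field_simp

lemma measurable_direction : Measurable (direction (F := E)) := by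
  unfold direction; fun_prop

lemma ae_tauMeasure_pos (β α p : ℝ) : ∀ᵐ s ∂tauMeasure β α p, 0 < s := by
  rw [tauMeasure, ae_withDensity_iff]
  · refine Filter.Eventually.of_forall fun s hs => ?_
    by_contra h
    simp [h] at hs
  · exact Measurable.ite (measurableSet_Ioo (a := (0 : ℝ)) (b := 1)) (by fun_prop) (by fun_prop)

lemma IsLevyMeasure.ae_norm_pos {F : Type*} [NormedAddCommGroup F] [MeasurableSpace F]
    {M : Measure F} (hM : IsLevyMeasure M) : ∀ᵐ x ∂M, 0 < ‖x‖ := by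
  rw [ae_iff]
  convert! hM.2.1 using 2
  ext x
  simp

lemma setLIntegral_upsilon_eq {β α p : ℝ} (hβα : β < α) (hp : 0 < p) {lam : ℝ} (hlam : 0 < lam)
    {M : Measure E} (hM : IsLevyMeasure M) {S : Set E} (hS : MeasurableSet S) :
    ∫⁻ z in direction ⁻¹' S, laplaceWeight β p lam z ∂Upsilon (tauMeasure β α p) M =
      ENNReal.ofReal (lam ^ (-((α - β) / p))) *
        ∫⁻ x in direction ⁻¹' S, laplaceWeight α p lam x ∂M := by
  have := hM.1
  have hC : MeasurableSet (direction ⁻¹' S : Set E) := measurable_direction hS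
  rw [← lintegral_indicator hC,
    lintegral_upsilon _ _ ((measurable_laplaceWeight β p lam).indicator hC),
    ← lintegral_const_mul _ (measurable_laplaceWeight α p lam), ← lintegral_indicator hC]
  refine lintegral_congr_ae ?_
  filter_upwards [hM.ae_norm_pos] with x hx
  have hae : ∀ᵐ s ∂tauMeasure β α p,
      (direction ⁻¹' S).indicator (laplaceWeight β p lam) (s • x) =
        (direction ⁻¹' S).indicator (fun _ =>
          ENNReal.ofReal ((s * ‖x‖) ^ β * Real.exp (-(lam * (s * ‖x‖) ^ (-p))))) x := by
    filter_upwards [ae_tauMeasure_pos β α p] with s hs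
    have hiff : s • x ∈ (direction ⁻¹' S : Set E) ↔ x ∈ (direction ⁻¹' S : Set E) := by
      rw [mem_preimage, direction_smul hs, mem_preimage]
    by_cases hxS : x ∈ (direction ⁻¹' S : Set E)
    · rw [indicator_of_mem (hiff.2 hxS), indicator_of_mem hxS, laplaceWeight, norm_smul,
        Real.norm_of_nonneg hs.le]
    · rw [indicator_of_notMem (mt hiff.1 hxS), indicator_of_notMem hxS]
  rw [lintegral_congr_ae hae]
  by_cases hxS : x ∈ (direction ⁻¹' S : Set E)
  · simp only [indicator_of_mem hxS]
    exact lintegral_tauMeasure_rpow_mul_exp hβα hp hlam hx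
  · simp [indicator_of_notMem hxS]

lemma lintegral_laplaceWeight_lt_top {β α p : ℝ} (hβα : β < α) (hα : α < 2) (hp : 0 < p)
    {lam : ℝ} (hlam : 0 < lam) {M : Measure E}
    (hM : M ∈ UpsilonDomain (tauMeasure β α p)) :
    ∫⁻ x, laplaceWeight α p lam x ∂M < ⊤ := by
  obtain ⟨hM, hTM⟩ := hM
  have := hM.1
  obtain ⟨c, hc, hcr⟩ := exists_mul_rpow_le_lintegral_tauMeasure hβα hp
  have hmeas : Measurable fun z : E => ENNReal.ofReal (min (‖z‖ ^ 2) 1) := by fun_prop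
  set C : ℝ := ((2 - α) / p / lam) ^ ((2 - α) / p) with hC
  have hC0 : 0 ≤ C := by
    have : 0 < 2 - α := by linarith
    positivity
  have hbound : ∀ᵐ x ∂M, laplaceWeight α p lam x ≤
      ENNReal.ofReal (C * 16) * ENNReal.ofReal (min (‖x‖ ^ 2) 1) +
        ENNReal.ofReal c⁻¹ *
          ∫⁻ s, ENNReal.ofReal (min (‖s • x‖ ^ 2) 1) ∂tauMeasure β α p := by
    filter_upwards [hM.ae_norm_pos] with x hx
    rcases le_total ‖x‖ 4 with h4 | h4
    · refine le_add_right ?_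
      rw [← ENNReal.ofReal_mul (by positivity)]
      refine ENNReal.ofReal_le_ofReal
        ((rpow_mul_exp_neg_rpow_neg_le hα hp hlam hx).trans ?_)
      rw [mul_assoc]
      refine mul_le_mul_of_nonneg_left ?_ hC0
      rcases le_total (‖x‖ ^ 2) 1 with h | h
      · rw [min_eq_left h]; nlinarith
      · rw [min_eq_right h]; nlinarith
    · refine le_add_left ?_
      have h := hcr ‖x‖ h4
      have e : ∫⁻ s, ENNReal.ofReal (min (‖s • x‖ ^ 2) 1) ∂tauMeasure β α p =
          ∫⁻ s, ENNReal.ofReal (min ((s * ‖x‖) ^ 2) 1) ∂tauMeasure β α p := by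
        simp only [norm_smul, mul_pow, Real.norm_eq_abs, sq_abs]
      rw [e]
      calc laplaceWeight α p lam x ≤ ENNReal.ofReal (c⁻¹ * (c * ‖x‖ ^ α)) := by
            refine ENNReal.ofReal_le_ofReal ?_
            rw [inv_mul_cancel_left₀ hc.ne']
            refine mul_le_of_le_one_right (by positivity) (Real.exp_le_one_iff.2 ?_)
            have : 0 ≤ lam * ‖x‖ ^ (-p) := by positivity
            linarith
        _ ≤ _ := by
            rw [ENNReal.ofReal_mul (by positivity)]
            gcongr
  have hinner : ∫⁻ x, ∫⁻ s, ENNReal.ofReal (min (‖s • x‖ ^ 2) 1) ∂tauMeasure β α p ∂M < ⊤ := by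
    rw [← lintegral_upsilon _ _ hmeas]
    exact hTM.2.2
  refine (lintegral_mono_ae hbound).trans_lt ?_
  rw [lintegral_add_left (hmeas.const_mul _), lintegral_const_mul _ hmeas,
    lintegral_const_mul' _ _ ENNReal.ofReal_ne_top]
  exact ENNReal.add_lt_top.2 ⟨ENNReal.mul_lt_top ENNReal.ofReal_lt_top hM.2.2,
    ENNReal.mul_lt_top ENNReal.ofReal_lt_top hinner⟩

/-- The law of `|x|^{-p}` under `|x|^α e^{-|x|^{-p}} M(dx)` restricted to a cone. -/
def radialMeasure (α p : ℝ) (S : Set E) (M : Measure E) : Measure ℝ :=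
  ((M.withDensity (laplaceWeight α p 1)).restrict (direction ⁻¹' S)).map fun x => ‖x‖ ^ (-p)

lemma measurable_norm_rpow {F : Type*} [NormedAddCommGroup F] [MeasurableSpace F]
    [BorelSpace F] (e : ℝ) : Measurable fun x : F => ‖x‖ ^ e := by
  fun_prop

lemma lintegral_exp_radialMeasure (α p t : ℝ) {S : Set E} (hS : MeasurableSet S)
    (M : Measure E) :
    ∫⁻ v, ENNReal.ofReal (Real.exp (t * v)) ∂radialMeasure α p S M =
      ∫⁻ x in direction ⁻¹' S, laplaceWeight α p (1 - t) x ∂M := by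
  rw [radialMeasure, lintegral_map (by fun_prop) (measurable_norm_rpow _),
    restrict_withDensity (measurable_direction hS),
    lintegral_withDensity_eq_lintegral_mul _ (measurable_laplaceWeight α p 1) (by fun_prop)]
  refine lintegral_congr fun x => ?_
  rw [Pi.mul_apply, laplaceWeight, laplaceWeight, ← ENNReal.ofReal_mul (by positivity), mul_assoc,
    ← Real.exp_add]
  congr 3
  ring

open ProbabilityTheory in
lemma radialMeasure_eq {β α p : ℝ} (hβα : β < α) (hα : α < 2) (hp : 0 < p) {M M' : Measure E}
    (hM : M ∈ UpsilonDomain (tauMeasure β α p)) (hM' : M' ∈ UpsilonDomain (tauMeasure β α p))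
    (h : Upsilon (tauMeasure β α p) M = Upsilon (tauMeasure β α p) M')
    {S : Set E} (hS : MeasurableSet S) :
    radialMeasure α p S M = radialMeasure α p S M' := by
  have hlt : ∀ N ∈ UpsilonDomain (tauMeasure β α p), ∀ t < 1,
      ∫⁻ v, ENNReal.ofReal (Real.exp (t * v)) ∂radialMeasure α p S N < ⊤ := by
    intro N hN t ht
    rw [lintegral_exp_radialMeasure α p t hS]
    exact (setLIntegral_le_lintegral _ _).trans_lt
      (lintegral_laplaceWeight_lt_top hβα hα hp (sub_pos.2 ht) hN)
  have hfin : ∀ N ∈ UpsilonDomain (tauMeasure β α p),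
      IsFiniteMeasure (radialMeasure α p S N) := fun N hN =>
    ⟨by simpa using hlt N hN 0 one_pos⟩
  have hint : ∀ N ∈ UpsilonDomain (tauMeasure β α p),
      0 ∈ interior (integrableExpSet id (radialMeasure α p S N)) := by
    intro N hN
    refine mem_interior.2 ⟨Iio 1, fun t ht => ?_, isOpen_Iio, mem_Iio.2 one_pos⟩
    refine ⟨by fun_prop, ?_⟩
    rw [hasFiniteIntegral_iff_ofReal (Filter.Eventually.of_forall fun v => (Real.exp_pos _).le)]
    exact hlt N hN t ht
  have := hfin M hM
  have := hfin M' hM'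
  refine ext_of_mgf_eventuallyEq (hint M hM) (hint M' hM') ?_
  filter_upwards [Iio_mem_nhds one_pos] with t ht
  have ht' : 0 < 1 - t := sub_pos.2 ht
  have hne : ENNReal.ofReal ((1 - t) ^ (-((α - β) / p))) ≠ 0 := by
    rw [ENNReal.ofReal_ne_zero_iff]; positivity
  have key := setLIntegral_upsilon_eq hβα hp ht' hM.1 hS
  rw [h, setLIntegral_upsilon_eq hβα hp ht' hM'.1 hS,
    ENNReal.mul_right_inj hne ENNReal.ofReal_ne_top] at key
  simp only [mgf, id]
  rw [integral_eq_lintegral_of_nonneg_ae (Filter.Eventually.of_forall fun v => (Real.exp_pos _).le)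
      (by fun_prop),
    integral_eq_lintegral_of_nonneg_ae (Filter.Eventually.of_forall fun v => (Real.exp_pos _).le)
      (by fun_prop),
    lintegral_exp_radialMeasure α p t hS, lintegral_exp_radialMeasure α p t hS, key]

lemma reconstruct_polar {F : Type*} [NormedAddCommGroup F] [NormedSpace ℝ F] {p : ℝ} (hp : p ≠ 0)
    (x : F) : (‖x‖ ^ (-p)) ^ (-(1 / p)) • direction x = x := by
  have e : -p * -(1 / p) = 1 := by field_simp
  rw [direction, ← Real.rpow_mul (norm_nonneg x), e, Real.rpow_one]
  by_cases hx : x = 0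
  · simp [hx]
  · rw [smul_smul, mul_inv_cancel₀ (norm_ne_zero_iff.2 hx), one_smul]

theorem upsilon_tauMeasure_injOn {β α p : ℝ} (hβα : β < α) (hα : α < 2) (hp : 0 < p) :
    InjOn (Upsilon (E := E) (tauMeasure β α p)) (UpsilonDomain (tauMeasure β α p)) := by
  intro M hM M' hM' h
  have hW := measurable_laplaceWeight (F := E) α p 1
  have hpolar : Measurable fun x : E => (‖x‖ ^ (-p), direction x) :=
    (measurable_norm_rpow _).prodMk measurable_direction
  have hrec : Measurable fun vu : ℝ × E => vu.1 ^ (-(1 / p)) • vu.2 := by fun_prop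
  have hQ : M.withDensity (laplaceWeight α p 1) = M'.withDensity (laplaceWeight α p 1) := by
    have : IsFiniteMeasure (M.withDensity (laplaceWeight α p 1)) :=
      isFiniteMeasure_withDensity (lintegral_laplaceWeight_lt_top hβα hα hp one_pos hM).ne
    have hmap : (M.withDensity (laplaceWeight α p 1)).map (fun x => (‖x‖ ^ (-p), direction x)) =
        (M'.withDensity (laplaceWeight α p 1)).map (fun x => (‖x‖ ^ (-p), direction x)) := by
      refine Measure.ext_prod fun {A S} hA hS => ?_
      have hrad : ∀ N : Measure E,
          (N.withDensity (laplaceWeight α p 1)).map (fun x => (‖x‖ ^ (-p), direction x))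
            (A ×ˢ S) = radialMeasure α p S N A := by
        intro N
        rw [Measure.map_apply hpolar (hA.prod hS), radialMeasure,
          Measure.map_apply (measurable_norm_rpow _) hA,
          Measure.restrict_apply (measurable_norm_rpow _ hA)]
        rfl
      rw [hrad, hrad, radialMeasure_eq hβα hα hp hM hM' h hS]
    have := congrArg (Measure.map fun vu : ℝ × E => vu.1 ^ (-(1 / p)) • vu.2) hmap
    rw [Measure.map_map hrec hpolar, Measure.map_map hrec hpolar] at this
    have hid : ((fun vu : ℝ × E => vu.1 ^ (-(1 / p)) • vu.2) ∘
        fun x => (‖x‖ ^ (-p), direction x)) = id :=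
      funext fun x => reconstruct_polar hp.ne' x
    rwa [hid, Measure.map_id, Measure.map_id] at this
  have hne : ∀ N ∈ UpsilonDomain (tauMeasure β α p),
      ∀ᵐ x : E ∂N, laplaceWeight α p 1 x ≠ 0 := by
    intro N hN
    filter_upwards [hN.1.ae_norm_pos] with x hx
    rw [laplaceWeight, ENNReal.ofReal_ne_zero_iff]
    positivity
  have hnt : ∀ N : Measure E, ∀ᵐ x : E ∂N, laplaceWeight α p 1 x ≠ ⊤ := fun N =>
    Filter.Eventually.of_forall fun x => ENNReal.ofReal_ne_top
  rw [← withDensity_inv_same hW (hne M hM) (hnt M), hQ,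
    withDensity_inv_same hW (hne M' hM') (hnt M')]

end Injectivity

theorem stmt12 (d : ℕ) (hd : 1 ≤ d) (β α p : ℝ) (hβα : β < α) (hα : α < 2) (hp : 0 < p) :
    ∀ M ∈ UpsilonDomain (E := EuclideanSpace ℝ (Fin d)) (tauMeasure β α p),
      ∀ M' ∈ UpsilonDomain (E := EuclideanSpace ℝ (Fin d)) (tauMeasure β α p),
        Upsilon (tauMeasure β α p) M = Upsilon (tauMeasure β α p) M' → M = M' := by
  exact fun M hM M' hM' h => upsilon_tauMeasure_injOn hβα hα hp hM hM' h
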